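/- Let R = k[x_0,…,x_n] be a polynomial ring over a field k, let I ⊆ R be a monomial ideal with big-height e, and let 𝒬 be the symbolic polyhedron of I. Then for all positive integers r, er·𝒬 ⊆ stairs(I^r); that is, for every point a in the dilate er·𝒬 there is an exponent vector b of a monomial in I^r with b ≤ a componentwise. In particular, I^{(er)} ⊆ I^r. -/

import Mathlib

open MvPolynomial Pointwise

noncomputable section

/-- The contraction to `R` of the extension of `I ^ m` to the localization of `R` at the
prime ideal `P`, i.e. `R ∩ I^m R_P`. -/
def contractedPower {R : Type*} [CommRing R] (I : Ideal R) (m : ℕ)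
    (P : Ideal R) (hP : P.IsPrime) : Ideal R :=
  letI := hP
  (Ideal.map (algebraMap R (Localization.AtPrime P)) (I ^ m)).comap
    (algebraMap R (Localization.AtPrime P))

/-- `Q_{⊆ P} = R ∩ I R_P`, the contraction to `R` of the extension of `I` to `R_P`. -/
def Qsub {R : Type*} [CommRing R] (I P : Ideal R) (hP : P.IsPrime) : Ideal R :=
  letI := hP
  (Ideal.map (algebraMap R (Localization.AtPrime P)) I).comap
    (algebraMap R (Localization.AtPrime P))

/-- The `m`-th symbolic power `I^{(m)} = ⋂_{P ∈ Ass(I)} (R ∩ I^m R_P)`. -/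
def symbolicPower {R : Type*} [CommRing R] (I : Ideal R) (m : ℕ) : Ideal R :=
  ⨅ P : {P : Ideal R // P ∈ associatedPrimes R (R ⧸ I)},
    contractedPower I m P.1 P.2.isPrime

/-- The set of associated primes of `I` that are maximal with respect to inclusion. -/
def maxAss {R : Type*} [CommRing R] (I : Ideal R) : Set (Ideal R) :=
  {P | P ∈ associatedPrimes R (R ⧸ I) ∧
    ∀ P' ∈ associatedPrimes R (R ⧸ I), P ≤ P' → P = P'}

/-- A monomial ideal: an ideal generated by monomials. -/
def IsMonomialIdeal {k : Type*} [Field k] {n : ℕ}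
    (I : Ideal (MvPolynomial (Fin (n + 1)) k)) : Prop :=
  ∃ S : Set (Fin (n + 1) →₀ ℕ),
    I = Ideal.span ((fun a => (monomial a (1 : k) : MvPolynomial (Fin (n + 1)) k)) '' S)

/-- A square-free monomial ideal: an ideal generated by square-free monomials. -/
def IsSquarefreeMonomialIdeal {k : Type*} [Field k] {n : ℕ}
    (I : Ideal (MvPolynomial (Fin (n + 1)) k)) : Prop :=
  ∃ S : Set (Fin (n + 1) →₀ ℕ), (∀ a ∈ S, ∀ i, a i ≤ 1) ∧
    I = Ideal.span ((fun a => (monomial a (1 : k) : MvPolynomial (Fin (n + 1)) k)) '' S)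

/-- The height of a prime ideal. -/
def primeHeight {R : Type*} [CommRing R] (P : Ideal R) (hP : P.IsPrime) : ℕ∞ :=
  Order.height (⟨P, hP⟩ : PrimeSpectrum R)

/-- `e` is the big-height of `I`: the maximum of the heights of the associated primes of `I`. -/
def IsBigHeight {R : Type*} [CommRing R] (I : Ideal R) (e : ℕ) : Prop :=
  (∀ P, ∀ h : P ∈ associatedPrimes R (R ⧸ I), primeHeight P h.isPrime ≤ (e : ℕ∞)) ∧
    ∃ P, ∃ h : P ∈ associatedPrimes R (R ⧸ I), primeHeight P h.isPrime = (e : ℕ∞)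

/-- The irrelevant maximal ideal `𝔪 = (x_0, …, x_n)`. -/
def mId (k : Type*) [Field k] (n : ℕ) : Ideal (MvPolynomial (Fin (n + 1)) k) :=
  Ideal.span (Set.range X)

/-- The exponent vector of a monomial, viewed as a point of `ℝ^{n+1}`. -/
def expVec {n : ℕ} (a : Fin (n + 1) →₀ ℕ) : Fin (n + 1) → ℝ := fun i => (a i : ℝ)

/-- `L(J)`: the set of exponent vectors of the monomials lying in `J`. -/
def latticePoints {k : Type*} [Field k] {n : ℕ}
    (J : Ideal (MvPolynomial (Fin (n + 1)) k)) : Set (Fin (n + 1) → ℝ) :=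
  {v | ∃ a : Fin (n + 1) →₀ ℕ, monomial a (1 : k) ∈ J ∧ v = expVec a}

/-- The exponent vectors of the minimal monomial generators of a monomial ideal. -/
def minGens {k : Type*} [Field k] {n : ℕ}
    (J : Ideal (MvPolynomial (Fin (n + 1)) k)) : Set (Fin (n + 1) →₀ ℕ) :=
  {a | monomial a (1 : k) ∈ J ∧
    ∀ b : Fin (n + 1) →₀ ℕ, monomial b (1 : k) ∈ J → b ≤ a → b = a}

/-- The symbolic polyhedron `𝒬 = ⋂_{P ∈ maxAss(I)} conv(L(Q_{⊆P}))`. -/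
def symbolicPolyhedron {k : Type*} [Field k] {n : ℕ}
    (I : Ideal (MvPolynomial (Fin (n + 1)) k)) : Set (Fin (n + 1) → ℝ) :=
  ⋂ P : {P : Ideal (MvPolynomial (Fin (n + 1)) k) // P ∈ maxAss I},
    convexHull ℝ (latticePoints (Qsub I P.1 P.2.1.isPrime))

/-- `α(J)`: the least degree of a nonzero (homogeneous) element of `J`. -/
def alphaI {k : Type*} [Field k] {n : ℕ}
    (J : Ideal (MvPolynomial (Fin (n + 1)) k)) : ℕ :=
  sInf {d | ∃ f ∈ J, f ≠ 0 ∧ MvPolynomial.IsHomogeneous f d}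

/-- `β(J)`: the largest degree of a minimal generator of the monomial ideal `J`. -/
def betaI {k : Type*} [Field k] {n : ℕ}
    (J : Ideal (MvPolynomial (Fin (n + 1)) k)) : ℕ :=
  sSup {d | ∃ a ∈ minGens J, ∑ i, a i = d}

/-- `α(𝒫) = inf { a_0 + ⋯ + a_n : a ∈ 𝒫 }` for a subset `𝒫 ⊆ ℝ^{n+1}`. -/
def alphaSet {n : ℕ} (P : Set (Fin (n + 1) → ℝ)) : ℝ :=
  sInf ((fun v => ∑ i, v i) '' P)

/-- The set of all conical (nonnegative) combinations of elements of `S`. -/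
def conicalHull {E : Type*} [AddCommMonoid E] [Module ℝ E] (S : Set E) : Set E :=
  {x | ∃ (t : Finset E) (c : E → ℝ), ↑t ⊆ S ∧ (∀ y, 0 ≤ c y) ∧ x = ∑ y ∈ t, c y • y}

/-- The staircase of a monomial ideal `J`. -/
def stairs {k : Type*} [Field k] {n : ℕ}
    (J : Ideal (MvPolynomial (Fin (n + 1)) k)) : Set (Fin (n + 1) → ℝ) :=
  {v | (∀ i, 0 ≤ v i) ∧
    ∃ a : Fin (n + 1) →₀ ℕ, monomial a (1 : k) ∈ J ∧ ∀ i, (a i : ℝ) ≤ v i}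

end

theorem mem_Qsub_iff {R : Type*} [CommRing R] {I P : Ideal R} (hP : P.IsPrime) {f : R} :
    f ∈ Qsub I P hP ↔ ∃ s ∉ P, s * f ∈ I := by
  have := hP
  simp only [Qsub, Ideal.mem_comap]
  rw [IsLocalization.algebraMap_mem_map_algebraMap_iff P.primeCompl]
  rfl

theorem mem_contractedPower_iff {R : Type*} [CommRing R] {I P : Ideal R} {m : ℕ}
    (hP : P.IsPrime) {f : R} :
    f ∈ contractedPower I m P hP ↔ ∃ s ∉ P, s * f ∈ I ^ m :=
  mem_Qsub_iff (I := I ^ m) hP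

theorem exists_le_mem_maxAss {R : Type*} [CommRing R] [IsNoetherianRing R] {I P : Ideal R}
    (hP : P ∈ associatedPrimes R (R ⧸ I)) : ∃ P' ∈ maxAss I, P ≤ P' := by
  obtain ⟨P', hle, hmax⟩ := (associatedPrimes.finite R (R ⧸ I)).exists_le_maximal hP
  exact ⟨P', ⟨hmax.prop, fun Q hQ hPQ => hmax.eq_of_le hQ hPQ⟩, hle⟩

/-- An element lying in all the localizations of `I` at maximal associated primes lies in `I`. -/
theorem mem_of_forall_mem_Qsub {R : Type*} [CommRing R] [IsNoetherianRing R] {I : Ideal R} {f : R}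
    (h : ∀ P (hP : P ∈ maxAss I), f ∈ Qsub I P hP.1.isPrime) : f ∈ I := by
  by_contra hf
  obtain ⟨P, hP, hle⟩ := exists_le_isAssociatedPrime_of_isNoetherianRing R
    (Ideal.Quotient.mk I f) (by rwa [Ne, Ideal.Quotient.eq_zero_iff_mem])
  obtain ⟨P', hP', hPP'⟩ := exists_le_mem_maxAss (I := I) hP
  obtain ⟨s, hs, hsf⟩ := (mem_Qsub_iff hP'.1.isPrime).1 (h P' hP')
  refine hs (hPP' (hle ?_))
  rw [Submodule.mem_colon_singleton, Submodule.mem_bot]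
  exact Ideal.Quotient.eq_zero_iff_mem.2 hsf

/-- The polynomials all of whose monomials have `w`-weight at least `N`. -/
def weightedOrderIdeal {σ : Type*} (k : Type*) [Field k] (w : σ → ℕ) (N : ℕ∞) :
    Ideal (MvPolynomial σ k) where
  carrier := {f | N ≤ (f : MvPowerSeries σ k).weightedOrder w}
  zero_mem' := by simp
  add_mem' {f g} hf hg := by
    simp only [Set.mem_ofPred_eq, coe_add] at *
    exact (le_min hf hg).trans (MvPowerSeries.min_weightedOrder_le_add w)
  smul_mem' f g hg := by
    simp only [Set.mem_ofPred_eq, smul_eq_mul, coe_mul, MvPowerSeries.weightedOrder_mul] at *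
    exact hg.trans le_add_self

section WeightedOrder

variable {σ k : Type*} [Field k] {w : σ → ℕ}

theorem mem_weightedOrderIdeal {N : ℕ∞} {f : MvPolynomial σ k} :
    f ∈ weightedOrderIdeal k w N ↔ N ≤ (f : MvPowerSeries σ k).weightedOrder w :=
  Iff.rfl

theorem mem_weightedOrderIdeal_iff_forall {N : ℕ∞} {f : MvPolynomial σ k} :
    f ∈ weightedOrderIdeal k w N ↔ ∀ d ∈ f.support, N ≤ Finsupp.weight w d := by
  constructor
  · intro h d hd
    refine (mem_weightedOrderIdeal.1 h).trans (MvPowerSeries.weightedOrder_le w ?_)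
    rwa [coeff_coe, ← mem_support_iff]
  · intro h
    refine MvPowerSeries.le_weightedOrder w fun d hd => ?_
    rw [coeff_coe]
    by_contra hc
    exact (h d (mem_support_iff.2 hc)).not_gt hd

theorem pow_le_weightedOrderIdeal {N : ℕ} {I : Ideal (MvPolynomial σ k)}
    (hI : I ≤ weightedOrderIdeal k w N) (m : ℕ) :
    I ^ m ≤ weightedOrderIdeal k w (m * N : ℕ) := by
  induction m with
  | zero => intro f _; simp [mem_weightedOrderIdeal]
  | succ m ih =>
    rw [pow_succ, Ideal.mul_le]
    intro f hf g hg
    have hf := ih hf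
    have hg := hI hg
    rw [mem_weightedOrderIdeal] at *
    rw [coe_mul, MvPowerSeries.weightedOrder_mul, add_mul, one_mul, Nat.cast_add]
    exact add_le_add hf hg

theorem isPrime_span_X_image (S : Set σ) :
    (Ideal.span (X '' S : Set (MvPolynomial σ k))).IsPrime := by
  classical
  set v : σ → ℕ := fun i => if i ∈ S then 1 else 0
  have key : ∀ f : MvPolynomial σ k,
      f ∈ Ideal.span (X '' S : Set (MvPolynomial σ k)) ↔ f ∈ weightedOrderIdeal k v 1 := by
    intro f
    rw [mem_ideal_span_X_image, mem_weightedOrderIdeal_iff_forall]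
    refine forall₂_congr fun d _ => ?_
    rw [← Nat.cast_one, Nat.cast_le, Nat.one_le_iff_ne_zero, Finsupp.weight_apply, Finsupp.sum,
      Ne, Finset.sum_eq_zero_iff]
    simp only [Finsupp.mem_support_iff, smul_eq_mul, mul_ite, mul_one, mul_zero, v]
    grind
  constructor
  · rw [Ideal.ne_top_iff_one, mem_ideal_span_X_image]
    simp
  · intro f g hfg
    rw [key, mem_weightedOrderIdeal, coe_mul, MvPowerSeries.weightedOrder_mul] at hfg
    simp only [key, mem_weightedOrderIdeal, Order.one_le_iff_ne_zero] at *
    by_contra! h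
    simp [h] at hfg

theorem card_le_primeHeight {P : Ideal (MvPolynomial σ k)} (hP : P.IsPrime) (S : Finset σ)
    (hS : ∀ i ∈ S, X i ∈ P) : (S.card : ℕ∞) ≤ primeHeight P hP := by
  classical
  suffices h : (S.card : ℕ∞) ≤ Order.height
      (⟨Ideal.span (X '' (S : Set σ)), isPrime_span_X_image _⟩ :
        PrimeSpectrum (MvPolynomial σ k)) by
    refine h.trans (Order.height_mono ?_)
    rw [← PrimeSpectrum.asIdeal_le_asIdeal, Ideal.span_le]
    rintro _ ⟨i, hi, rfl⟩
    exact hS i hi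
  clear hS
  induction S using Finset.induction_on with
  | empty => simp
  | insert a S ha ih =>
    rw [Finset.card_insert_of_notMem ha, Nat.cast_add, Nat.cast_one]
    refine (add_le_add_left ih 1).trans (Order.height_add_one_le ?_)
    rw [← PrimeSpectrum.asIdeal_lt_asIdeal]
    refine lt_of_le_of_ne (Ideal.span_mono (Set.image_mono (by simp))) fun h => ha ?_
    have hX : (X a : MvPolynomial σ k) ∈ Ideal.span (X '' (S : Set σ)) := by
      simp only at h
      rw [h]
      exact Ideal.subset_span ⟨a, by simp, rfl⟩
    rw [mem_ideal_span_X_image] at hX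
    obtain ⟨i, hi, hne⟩ := hX (Finsupp.single a 1) (by simp [support_X])
    obtain rfl : a = i := by
      by_contra hai
      simp [hai] at hne
    exact hi

/-- A monomial belongs to the localization of `I` at `P` as soon as some monomial in that
localization divides it up to variables outside `P`. -/
theorem monomial_mem_Qsub {I P : Ideal (MvPolynomial σ k)} (hP : P.IsPrime)
    {a b : σ →₀ ℕ} (hb : monomial b (1 : k) ∈ Qsub I P hP)
    (hab : ∀ i, (X i : MvPolynomial σ k) ∈ P → b i ≤ a i) :
    monomial a (1 : k) ∈ Qsub I P hP := by
  obtain ⟨s, hs, hsb⟩ := (mem_Qsub_iff hP).1 hb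
  refine (mem_Qsub_iff hP).2 ⟨s * monomial (b - a) 1, ?_, ?_⟩
  · rw [hP.mul_mem_iff_mem_or_mem, not_or]
    refine ⟨hs, fun hmem => ?_⟩
    rw [monomial_eq, C_1, one_mul, Finsupp.prod, hP.prod_mem_iff] at hmem
    obtain ⟨i, hi, hX⟩ := hmem
    have := hab i (hP.mem_of_pow_mem _ hX)
    rw [Finsupp.mem_support_iff, Finsupp.tsub_apply] at hi
    omega
  · have h : b - a + a = b + (a - b) := by
      ext i
      simp only [Finsupp.add_apply, Finsupp.tsub_apply]
      omega
    rw [mul_assoc, monomial_mul, h, mul_one,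
      show monomial (b + (a - b)) (1 : k) = monomial b 1 * monomial (a - b) 1 by
        simp [monomial_mul], ← mul_assoc]
    exact I.mul_mem_right _ hsb

end WeightedOrder


theorem le_Qsub {R : Type*} [CommRing R] {I P : Ideal R} (hP : P.IsPrime) : I ≤ Qsub I P hP :=
  Ideal.le_comap_map

/-- Every real point `a` of `e • 𝒬` has the monomial with exponents `⌊a⌋` in `I`. -/
theorem monomial_floor_mem {k : Type*} [Field k] {n : ℕ}
    {I : Ideal (MvPolynomial (Fin (n + 1)) k)} {e : ℕ}
    (he : ∀ P,
      ∀ h : P ∈ associatedPrimes (MvPolynomial (Fin (n + 1)) k) (_ ⧸ I),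
        primeHeight P h.isPrime ≤ (e : ℕ∞))
    {p : Fin (n + 1) → ℝ} (hp : p ∈ symbolicPolyhedron I) :
    monomial (Finsupp.equivFunOnFinite.symm fun i => ⌊(e : ℝ) * p i⌋₊) (1 : k) ∈ I := by
  classical
  set a : Fin (n + 1) →₀ ℕ := Finsupp.equivFunOnFinite.symm fun i => ⌊(e : ℝ) * p i⌋₊
  have ha_apply : ∀ i, a i = ⌊(e : ℝ) * p i⌋₊ := fun i => rfl
  refine mem_of_forall_mem_Qsub fun P hP => ?_
  have hPp := hP.1.isPrime
  by_contra hna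
  set T : Finset (Fin (n + 1)) := {i | (X i : MvPolynomial (Fin (n + 1)) k) ∈ P} with hT
  have hcard : T.card ≤ e := by
    exact_mod_cast (card_le_primeHeight hPp T (by simp [hT])).trans (he P hP.1)
  let φ : (Fin (n + 1) → ℝ) →ₗ[ℝ] ℝ :=
    ∑ i ∈ T, ((a i : ℝ) + 1)⁻¹ • LinearMap.proj i
  have hφ : ∀ v, φ v = ∑ i ∈ T, ((a i : ℝ) + 1)⁻¹ * v i := fun v => by
    simp [φ, LinearMap.sum_apply]
  have h1 : 1 ≤ φ p := by
    have hmem := Set.mem_iInter.1 hp ⟨P, hP⟩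
    refine convexHull_min ?_ (convex_halfSpace_ge φ.isLinear 1) hmem
    rintro _ ⟨b, hb, rfl⟩
    obtain ⟨j, hj, hlt⟩ : ∃ j, (X j : MvPolynomial (Fin (n + 1)) k) ∈ P ∧ a j < b j := by
      by_contra! h
      exact hna (monomial_mem_Qsub hPp hb h)
    rw [Set.mem_ofPred_eq, hφ]
    refine le_trans ?_ (Finset.single_le_sum (f := fun i => ((a i : ℝ) + 1)⁻¹ * expVec b i)
      (fun i _ => by simp only [expVec]; positivity) (by simpa [hT] using hj : j ∈ T))
    have : (a j : ℝ) + 1 ≤ b j := by exact_mod_cast hlt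
    rw [inv_mul_eq_div, one_le_div (by positivity)]
    exact this
  have hTne : T.Nonempty := by
    by_contra h
    rw [Finset.not_nonempty_iff_eq_empty] at h
    rw [hφ, h] at h1
    norm_num at h1
  have h2 : (e : ℝ) * φ p < T.card := by
    rw [hφ, Finset.mul_sum, Finset.card_eq_sum_ones, Nat.cast_sum]
    refine Finset.sum_lt_sum_of_nonempty hTne fun i _ => ?_
    have := Nat.lt_floor_add_one ((e : ℝ) * p i)
    rw [mul_left_comm, inv_mul_eq_div, Nat.cast_one, div_lt_one (by positivity), ha_apply]
    exact this
  have h3 : (T.card : ℝ) ≤ e := by exact_mod_cast hcard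
  nlinarith

theorem nonneg_of_mem_symbolicPolyhedron {k : Type*} [Field k] {n : ℕ}
    {I : Ideal (MvPolynomial (Fin (n + 1)) k)} (hI : (maxAss I).Nonempty)
    {p : Fin (n + 1) → ℝ} (hp : p ∈ symbolicPolyhedron I) (i : Fin (n + 1)) : 0 ≤ p i := by
  obtain ⟨P, hP⟩ := hI
  refine convexHull_min ?_ (convex_halfSpace_ge (LinearMap.proj (R := ℝ) i).isLinear 0)
    (Set.mem_iInter.1 hp ⟨P, hP⟩)
  rintro _ ⟨b, -, rfl⟩
  simp [expVec]

/-- If `x ^ v` occurs in an element of `I ^ (e * r)` localized at the associated primes of `I`,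
then the monomial with exponents `⌊v / r⌋` lies in `I`. -/
theorem monomial_div_mem {k : Type*} [Field k] {n : ℕ}
    {I : Ideal (MvPolynomial (Fin (n + 1)) k)} (hmon : IsMonomialIdeal I) (hI : I ≠ ⊥)
    {e r : ℕ} (hr : 1 ≤ r)
    (he : ∀ P,
      ∀ h : P ∈ associatedPrimes (MvPolynomial (Fin (n + 1)) k) (_ ⧸ I),
        primeHeight P h.isPrime ≤ (e : ℕ∞))
    {f : MvPolynomial (Fin (n + 1)) k} (hf : f ∈ symbolicPower I (e * r))
    {v : Fin (n + 1) →₀ ℕ} (hv : v ∈ f.support) :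
    monomial (v.mapRange (· / r) (Nat.zero_div r)) (1 : k) ∈ I := by
  classical
  set a : Fin (n + 1) →₀ ℕ := v.mapRange (· / r) (Nat.zero_div r)
  have ha_apply : ∀ i, a i = v i / r := fun i => rfl
  refine mem_of_forall_mem_Qsub fun P hP => ?_
  have hPp := hP.1.isPrime
  by_contra hna
  set T : Finset (Fin (n + 1)) := {i | (X i : MvPolynomial (Fin (n + 1)) k) ∈ P} with hT
  have hcard : T.card ≤ e := by
    exact_mod_cast (card_le_primeHeight hPp T (by simp [hT])).trans (he P hP.1)
  set D : ℕ := ∏ i, (a i + 1)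
  have hDpos : 0 < D := Finset.prod_pos fun i _ => Nat.succ_pos _
  have hdvd : ∀ i, (a i + 1) * (D / (a i + 1)) = D := fun i =>
    Nat.mul_div_cancel' (Finset.dvd_prod_of_mem (fun i => a i + 1) (Finset.mem_univ i))
  set w : Fin (n + 1) → ℕ := fun i => if i ∈ T then D / (a i + 1) else 0 with hw
  have hweight : ∀ d : Fin (n + 1) →₀ ℕ,
      Finsupp.weight w d = ∑ i ∈ T, d i * (D / (a i + 1)) := fun d => by
    rw [Finsupp.weight_apply, Finsupp.sum_fintype _ _ (by simp)]
    simp [hw, Finset.sum_ite_mem]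
  have hIw : I ≤ weightedOrderIdeal k w D := by
    obtain ⟨S, hS⟩ := hmon
    nth_rewrite 1 [hS]
    rw [Ideal.span_le]
    rintro _ ⟨b, hbS, rfl⟩
    have hb : monomial b (1 : k) ∈ Qsub I P hPp :=
      le_Qsub hPp (hS ▸ Ideal.subset_span ⟨b, hbS, rfl⟩)
    obtain ⟨j, hj, hlt⟩ : ∃ j, (X j : MvPolynomial (Fin (n + 1)) k) ∈ P ∧ a j < b j := by
      by_contra! h
      exact hna (monomial_mem_Qsub hPp hb h)
    simp only [SetLike.mem_coe, mem_weightedOrderIdeal_iff_forall]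
    intro d hd
    obtain rfl : d = b := by simpa using support_monomial_subset hd
    rw [Nat.cast_le, hweight]
    refine le_trans ?_ (Finset.single_le_sum (f := fun i => d i * (D / (a i + 1)))
      (fun i _ => Nat.zero_le _) (by simpa [hT] using hj : j ∈ T))
    exact (hdvd j).symm.le.trans (Nat.mul_le_mul_right _ hlt)
  obtain ⟨s, hs, hsf⟩ := (mem_contractedPower_iff hPp).1
    ((Submodule.mem_iInf _).1 hf ⟨P, hP.1⟩)
  have hs0 : (s : MvPowerSeries (Fin (n + 1)) k).weightedOrder w = 0 := by
    have hsT : s ∉ Ideal.span (X '' (T : Set (Fin (n + 1)))) := fun hmem => by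
      refine hs (Ideal.span_le.2 ?_ hmem)
      rintro _ ⟨i, hi, rfl⟩
      simpa [hT] using hi
    rw [mem_ideal_span_X_image] at hsT
    push Not at hsT
    obtain ⟨d, hd, hd0⟩ := hsT
    have := mem_weightedOrderIdeal_iff_forall.1
      (mem_weightedOrderIdeal (w := w).2 le_rfl) d hd
    rw [hweight, Finset.sum_eq_zero fun i hi => by rw [hd0 i hi, zero_mul]] at this
    simpa using this
  have hsf' := pow_le_weightedOrderIdeal hIw _ hsf
  rw [mem_weightedOrderIdeal, coe_mul, MvPowerSeries.weightedOrder_mul, hs0, zero_add,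
    ← mem_weightedOrderIdeal] at hsf'
  have hle : e * r * D ≤ ∑ i ∈ T, v i * (D / (a i + 1)) := by
    rw [← hweight]
    exact_mod_cast mem_weightedOrderIdeal_iff_forall.1 hsf' v hv
  have hTne : T.Nonempty := by
    by_contra hTe
    obtain ⟨g, hg, hg0⟩ := Submodule.exists_mem_ne_zero_of_ne_bot hI
    obtain ⟨d, hd⟩ := support_nonempty.2 hg0
    have := mem_weightedOrderIdeal_iff_forall.1 (hIw hg) d hd
    rw [hweight, Finset.not_nonempty_iff_eq_empty.1 hTe, Finset.sum_empty, Nat.cast_le] at this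
    omega
  have hlt : ∑ i ∈ T, v i * (D / (a i + 1)) < ∑ i ∈ T, r * D := by
    refine Finset.sum_lt_sum_of_nonempty hTne fun i _ => ?_
    have h1 : v i < r * (a i + 1) := by
      rw [ha_apply]
      exact Nat.lt_mul_div_succ _ hr
    have h2 : 0 < D / (a i + 1) := Nat.pos_of_mul_pos_left ((hdvd i).symm ▸ hDpos)
    calc v i * (D / (a i + 1)) < r * (a i + 1) * (D / (a i + 1)) :=
          Nat.mul_lt_mul_of_pos_right h1 h2
      _ = r * D := by rw [mul_assoc, hdvd]
  rw [Finset.sum_const, smul_eq_mul] at hlt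
  have : T.card * (r * D) ≤ e * (r * D) := Nat.mul_le_mul_right _ hcard
  rw [mul_assoc] at hle
  omega

theorem dilate_symbolic_polyhedron_subset_stairs {k : Type*} [Field k] {n : ℕ}
    (I : Ideal (MvPolynomial (Fin (n + 1)) k)) (hmon : IsMonomialIdeal I) (hI : I ≠ ⊥)
    (e : ℕ) (he : IsBigHeight I e) (r : ℕ) (hr : 1 ≤ r) :
    ((e * r : ℕ) : ℝ) • symbolicPolyhedron I ⊆ stairs (I ^ r) ∧
      symbolicPower I (e * r) ≤ I ^ r := by
  have hpow : ∀ a : Fin (n + 1) →₀ ℕ, monomial a (1 : k) ∈ I →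
      monomial (r • a) (1 : k) ∈ I ^ r := fun a ha => by
    simpa [monomial_pow] using Ideal.pow_mem_pow ha r
  constructor
  · rintro _ ⟨p, hp, rfl⟩
    have hne : (maxAss I).Nonempty := by
      obtain ⟨P, hP, -⟩ := he.2
      obtain ⟨P', hP', -⟩ := exists_le_mem_maxAss hP
      exact ⟨P', hP'⟩
    have hp0 := nonneg_of_mem_symbolicPolyhedron hne hp
    refine ⟨fun i => mul_nonneg (Nat.cast_nonneg _) (hp0 i), _,
      hpow _ (monomial_floor_mem he.1 hp), fun i => ?_⟩
    have := Nat.floor_le (mul_nonneg (Nat.cast_nonneg e) (hp0 i))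
    simp only [Finsupp.smul_apply, Finsupp.equivFunOnFinite_symm_apply_apply, Pi.smul_apply,
      smul_eq_mul, Nat.cast_mul]
    calc (r : ℝ) * (⌊(e : ℝ) * p i⌋₊ : ℝ) ≤ r * (e * p i) := by gcongr
      _ = e * r * p i := by ring
  · intro f hf
    rw [f.as_sum]
    refine Ideal.sum_mem _ fun v hv => ?_
    have hmem := hpow _ (monomial_div_mem hmon hI hr he.1 hf hv)
    refine Ideal.mem_of_dvd _ (monomial_dvd_monomial.2 ⟨Or.inr fun i => ?_, one_dvd _⟩) hmem
    simpa using Nat.mul_div_le (v i) r
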